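/- Let X be a variable and e, f expressions. If μ X = e ≡ μ X = f, then for every valuation η: (1) for every r ∈ R̂ such that r ≥ η[X:=r](e), there exists r' ∈ R̂ with r' ≤ r and r' = η[X:=r'](f); and (2) for every r ∈ R̂ such that r ≥ η[X:=r](f), there exists r' ∈ R̂ with r' ≤ r and r' = η[X:=r'](e). -/

import Mathlib

namespace RESpaper

noncomputable section

/-- Addition on the extended reals in which `⊤` (i.e. `∞`) dominates. -/
def eadd (x y : EReal) : EReal := if x = ⊤ ∨ y = ⊤ then ⊤ else x + y

/-- The operator `eq-∞`. -/
def eqNegInfVal (x : EReal) : EReal := if x = ⊥ then ⊥ else ⊤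

/-- The operator `eq∞`. -/
def eqInfVal (x : EReal) : EReal := if x = ⊤ then ⊤ else ⊥

open Classical in
/-- The sum, with respect to `eadd`, of a finite family of extended reals. -/
def eSum {ι : Type*} (s : Finset ι) (e : ι → EReal) : EReal :=
  if ∃ i ∈ s, e i = ⊤ then ⊤ else ∑ i ∈ s, e i

/-- Syntax of expressions over a set `V` of variables. -/
inductive Expr (V : Type*) where
  | var : V → Expr V
  | const : EReal → Expr V
  | scale : {c : ℝ // 0 < c} → Expr V → Expr V
  | add : Expr V → Expr V → Expr V
  | emin : Expr V → Expr V → Expr V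
  | emax : Expr V → Expr V → Expr V
  | condL : Expr V → Expr V → Expr V → Expr V   -- (e₁ ⇒ e₂ ◇ e₃)
  | condR : Expr V → Expr V → Expr V → Expr V   -- (e₁ → e₂ ◇ e₃)
  | eqm : Expr V → Expr V                       -- eq-∞(e)

variable {V : Type*}

/-- Evaluation of an expression under a valuation `η`. -/
def Expr.eval (η : V → EReal) : Expr V → EReal
  | var X => η X
  | const d => d
  | scale c e => (c.1 : EReal) * Expr.eval η e
  | add e₁ e₂ => eadd (Expr.eval η e₁) (Expr.eval η e₂)
  | emin e₁ e₂ => Expr.eval η e₁ ⊓ Expr.eval η e₂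
  | emax e₁ e₂ => Expr.eval η e₁ ⊔ Expr.eval η e₂
  | condL e₁ e₂ e₃ =>
      if Expr.eval η e₁ ≤ 0 then Expr.eval η e₂ ⊓ Expr.eval η e₃ else Expr.eval η e₃
  | condR e₁ e₂ e₃ =>
      if Expr.eval η e₁ < 0 then Expr.eval η e₂ else Expr.eval η e₂ ⊔ Expr.eval η e₃
  | eqm e => eqNegInfVal (Expr.eval η e)

/-- The set of variables occurring in an expression. -/
def Expr.occ : Expr V → Set V
  | var X => {X}
  | const _ => ∅
  | scale _ e => Expr.occ e
  | add e₁ e₂ => Expr.occ e₁ ∪ Expr.occ e₂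
  | emin e₁ e₂ => Expr.occ e₁ ∪ Expr.occ e₂
  | emax e₁ e₂ => Expr.occ e₁ ∪ Expr.occ e₂
  | condL e₁ e₂ e₃ => Expr.occ e₁ ∪ Expr.occ e₂ ∪ Expr.occ e₃
  | condR e₁ e₂ e₃ => Expr.occ e₁ ∪ Expr.occ e₂ ∪ Expr.occ e₃
  | eqm e => Expr.occ e

/-- `e` contains no occurrence of the conditional operators. -/
def Expr.noCond : Expr V → Prop
  | var _ => True
  | const _ => True
  | scale _ e => Expr.noCond e
  | add e₁ e₂ => Expr.noCond e₁ ∧ Expr.noCond e₂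
  | emin e₁ e₂ => Expr.noCond e₁ ∧ Expr.noCond e₂
  | emax e₁ e₂ => Expr.noCond e₁ ∧ Expr.noCond e₂
  | condL _ _ _ => False
  | condR _ _ _ => False
  | eqm e => Expr.noCond e

/-- Syntactic substitution `e[X := g]`. -/
def Expr.subst [DecidableEq V] (X : V) (g : Expr V) : Expr V → Expr V
  | var Y => if Y = X then g else var Y
  | const d => const d
  | scale c e => scale c (Expr.subst X g e)
  | add e₁ e₂ => add (Expr.subst X g e₁) (Expr.subst X g e₂)
  | emin e₁ e₂ => emin (Expr.subst X g e₁) (Expr.subst X g e₂)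
  | emax e₁ e₂ => emax (Expr.subst X g e₁) (Expr.subst X g e₂)
  | condL e₁ e₂ e₃ => condL (Expr.subst X g e₁) (Expr.subst X g e₂) (Expr.subst X g e₃)
  | condR e₁ e₂ e₃ => condR (Expr.subst X g e₁) (Expr.subst X g e₂) (Expr.subst X g e₃)
  | eqm e => eqm (Expr.subst X g e)

/-- `(Σ_{(c,X) ∈ cs} c·X) + rest`. -/
def scaledSum (cs : List ({c : ℝ // 0 < c} × V)) (rest : Expr V) : Expr V :=
  cs.foldr (fun p acc => Expr.add (Expr.scale p.1 (Expr.var p.2)) acc) rest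

/-- `(Σ_{X ∈ ms} eq-∞(X)) + rest`. -/
def eqmSum (ms : List V) (rest : Expr V) : Expr V :=
  ms.foldr (fun X acc => Expr.add (Expr.eqm (Expr.var X)) acc) rest

/-- A term of the shape `(Σ_{X∈𝒳'} c^X·X) + (Σ_{X∈𝒳''} eq-∞(X)) + d`
with the variables in each of the two sums pairwise distinct. -/
def IsSimpleTerm (e : Expr V) : Prop :=
  ∃ (cs : List ({c : ℝ // 0 < c} × V)) (ms : List V) (d : EReal),
    (cs.map Prod.snd).Nodup ∧ ms.Nodup ∧ e = scaledSum cs (eqmSum ms (Expr.const d))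

/-- Finite disjunction; the empty disjunction is `−∞`. -/
def disjList : List (Expr V) → Expr V
  | [] => Expr.const ⊥
  | [e] => e
  | e :: es => Expr.emax e (disjList es)

/-- Finite conjunction; the empty conjunction is `∞`. -/
def conjList : List (Expr V) → Expr V
  | [] => Expr.const ⊤
  | [e] => e
  | e :: es => Expr.emin e (conjList es)

/-- Simple conjunctive normal form. -/
def IsSimpleCNF (e : Expr V) : Prop :=
  ∃ ls : List (List (Expr V)),
    (∀ l ∈ ls, ∀ t ∈ l, IsSimpleTerm t) ∧ e = conjList (ls.map disjList)

/-- Simple disjunctive normal form. -/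
def IsSimpleDNF (e : Expr V) : Prop :=
  ∃ ls : List (List (Expr V)),
    (∀ l ∈ ls, ∀ t ∈ l, IsSimpleTerm t) ∧ e = disjList (ls.map conjList)

/-- Conjunctive normal form. -/
inductive IsCNF : Expr V → Prop where
  | simple {e : Expr V} : IsSimpleCNF e → IsCNF e
  | condL {e₁ e₂ e₃ : Expr V} :
      IsSimpleCNF e₁ → IsCNF e₂ → IsCNF e₃ → IsCNF (Expr.condL e₁ e₂ e₃)
  | condR {e₁ e₂ e₃ : Expr V} :
      IsSimpleCNF e₁ → IsCNF e₂ → IsCNF e₃ → IsCNF (Expr.condR e₁ e₂ e₃)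

/-- Disjunctive normal form. -/
inductive IsDNF : Expr V → Prop where
  | simple {e : Expr V} : IsSimpleDNF e → IsDNF e
  | condL {e₁ e₂ e₃ : Expr V} :
      IsSimpleDNF e₁ → IsDNF e₂ → IsDNF e₃ → IsDNF (Expr.condL e₁ e₂ e₃)
  | condR {e₁ e₂ e₃ : Expr V} :
      IsSimpleDNF e₁ → IsDNF e₂ → IsDNF e₃ → IsDNF (Expr.condR e₁ e₂ e₃)

/-- Fixed-point symbols. -/
inductive FP where
  | mu : FP
  | nu : FP

/-- A real equation system: a finite sequence of fixed-point equations `σ X = e`. -/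
abbrev RES (V : Type*) := List (FP × V × Expr V)

/-- The bound variables of a RES. -/
def bnd (E : RES V) : List V := E.map (fun p => p.2.1)

variable [DecidableEq V]

/-- The solution `[[ℰ]]η` of a real equation system. -/
def sol : RES V → (V → EReal) → V → EReal
  | [], η => η
  | (FP.mu, X, e) :: E, η =>
      sol E (Function.update η X
        (sInf {r : EReal | Expr.eval (sol E (Function.update η X r)) e ≤ r}))
  | (FP.nu, X, e) :: E, η =>
      sol E (Function.update η X
        (sSup {r : EReal | r ≤ Expr.eval (sol E (Function.update η X r)) e}))

/-- Equivalence of real equation systems. -/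
def REquiv (E E' : RES V) : Prop :=
  ∀ F : RES V, (∀ Y ∈ bnd F, Y ∉ bnd E ∧ Y ∉ bnd E') →
    ∀ η : V → EReal, sol (E ++ F) η = sol (E' ++ F) η


theorem eadd_mono {a b c d : EReal} (h₁ : a ≤ b) (h₂ : c ≤ d) : eadd a c ≤ eadd b d := by
  unfold eadd
  by_cases hr : b = ⊤ ∨ d = ⊤
  · simp [hr]
  · have hl : ¬(a = ⊤ ∨ c = ⊤) := by
      rintro (rfl | rfl)
      · exact hr (Or.inl (top_le_iff.mp h₁))
      · exact hr (Or.inr (top_le_iff.mp h₂))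
    rw [if_neg hl, if_neg hr]
    exact add_le_add h₁ h₂

theorem eqNegInfVal_mono {a b : EReal} (h : a ≤ b) : eqNegInfVal a ≤ eqNegInfVal b := by
  unfold eqNegInfVal
  by_cases hb : b = ⊥
  · subst hb
    simp [le_bot_iff.mp h]
  · simp [hb]

theorem Expr.eval_mono {V : Type*} (e : Expr V) : Monotone fun η : V → EReal => e.eval η := by
  intro η θ h
  induction e with
  | var X => exact h X
  | const d => exact le_rfl
  | scale c e ih => exact mul_le_mul_of_nonneg_left ih (EReal.coe_nonneg.mpr c.2.le)
  | add e₁ e₂ ih₁ ih₂ => exact eadd_mono ih₁ ih₂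
  | emin e₁ e₂ ih₁ ih₂ => exact inf_le_inf ih₁ ih₂
  | emax e₁ e₂ ih₁ ih₂ => exact sup_le_sup ih₁ ih₂
  | condL e₁ e₂ e₃ ih₁ ih₂ ih₃ =>
    simp only [Expr.eval] at *
    split_ifs with hη hθ hθ
    · exact inf_le_inf ih₂ ih₃
    · exact inf_le_right.trans ih₃
    · exact absurd (ih₁.trans hθ) hη
    · exact ih₃
  | condR e₁ e₂ e₃ ih₁ ih₂ ih₃ =>
    simp only [Expr.eval] at *
    split_ifs with hη hθ hθ
    · exact ih₂
    · exact ih₂.trans le_sup_left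
    · exact absurd (ih₁.trans_lt hθ) hη
    · exact sup_le_sup ih₂ ih₃
  | eqm e ih => exact eqNegInfVal_mono ih

/-- Evaluation of `e` as a monotone function of the value of the variable `X`. -/
def Expr.evalHom {V : Type*} [DecidableEq V] (η : V → EReal) (X : V) (e : Expr V) :
    EReal →o EReal where
  toFun r := e.eval (Function.update η X r)
  monotone' _ _ h := e.eval_mono (Function.update_mono h)

theorem sol_mu_self {V : Type*} [DecidableEq V] (η : V → EReal) (X : V) (e : Expr V) :
    sol [(FP.mu, X, e)] η X = (e.evalHom η X).lfp := by
  simp only [sol, Function.update_self]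
  rfl

/-- A pre-fixed point of `e` bounds a fixed point of `f` whenever the two least fixed points
agree. -/
theorem exists_fixed_le_of_lfp_eq {α : Type*} [CompleteLattice α] {e f : α →o α}
    (h : e.lfp = f.lfp) {r : α} (hr : e r ≤ r) : ∃ r' ≤ r, f r' = r' :=
  ⟨f.lfp, h ▸ e.lfp_le hr, f.map_lfp⟩

/-- necessary condition following from `μ X = e ≡ μ X = f`. -/
theorem generic2_mu (X : V) (e f : Expr V)
    (h : REquiv [(FP.mu, X, e)] [(FP.mu, X, f)]) (η : V → EReal) :
    (∀ r : EReal, Expr.eval (Function.update η X r) e ≤ r →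
      ∃ r' : EReal, r' ≤ r ∧ Expr.eval (Function.update η X r') f = r') ∧
    (∀ r : EReal, Expr.eval (Function.update η X r) f ≤ r →
      ∃ r' : EReal, r' ≤ r ∧ Expr.eval (Function.update η X r') e = r') := by
  have hlfp : (e.evalHom η X).lfp = (f.evalHom η X).lfp := by
    rw [← sol_mu_self, ← sol_mu_self]
    exact congrFun (h [] (by simp [bnd]) η) X
  exact ⟨fun _ hr => exists_fixed_le_of_lfp_eq hlfp hr,
    fun _ hr => exists_fixed_le_of_lfp_eq hlfp.symm hr⟩

end
end RESpaper
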